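/- arXiv:2411.07538 — 5 statements merged into one kernel-verified Lean document; each statement's English description precedes it below -/
import Mathlib

section
/- For the Softmax-attention Transformer with N = 1, n = 2, H = 1, D = d = 2, take X_1 = I_2 (the 2×2 identity), W^O = (1/a, 1/a)^T, and W^V = [[2a, a],[a, 2a]] for any constant a ≠ 0. Then for every choice of W^Q ∈ ℝ^{2×2} and W^K ∈ ℝ^{2×2}, the gradient of the loss with respect to the query weights vanishes: ∇_{W^Q} f(M; X_1) = 0. Consequently, for any label y_1 ∈ ℝ² with MH(M; X_1) ≠ y_1, the point M is a stationary point of W^Q ↦ f(M; X_1) at which f(M; X_1) > 0, i.e., a non-globally-optimal stationary point. -/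
open scoped BigOperators
open scoped Matrix

noncomputable section

namespace Paper

/-- Euclidean (`ℓ²`) norm of a finite family of reals. -/
def enorm {ι : Type*} [Fintype ι] (v : ι → ℝ) : ℝ := Real.sqrt (∑ i, v i ^ 2)

/-- Frobenius norm of a real matrix. -/
def frob {m k : Type*} [Fintype m] [Fintype k] (A : Matrix m k ℝ) : ℝ :=
  Real.sqrt (∑ i, ∑ j, A i j ^ 2)

/-- Largest singular value of a real matrix: `sup` of `‖A v‖₂` over unit vectors `v`. -/
def sigmaMax {m k : Type*} [Fintype m] [Fintype k] (A : Matrix m k ℝ) : ℝ :=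
  sSup {c | ∃ v : k → ℝ, (∑ j, v j ^ 2) = 1 ∧ c = enorm (A.mulVec v)}

/-- Smallest singular value of a (full row rank) real matrix:
`inf` of `‖uᵀ A‖₂` over unit vectors `u`. -/
def sigmaMin {m k : Type*} [Fintype m] [Fintype k] (A : Matrix m k ℝ) : ℝ :=
  sInf {c | ∃ u : m → ℝ, (∑ i, u i ^ 2) = 1 ∧ c = enorm (Matrix.vecMul u A)}

variable {N n D d H : ℕ}

/-- Attention logits `C = X W^Q (X W^K)ᵀ / √d`. -/
def attnC (WQ WK : Matrix (Fin D) (Fin d) ℝ) (Xi : Matrix (Fin n) (Fin D) ℝ) :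
    Matrix (Fin n) (Fin n) ℝ :=
  (Real.sqrt (d : ℝ))⁻¹ • (Xi * WQ * (Xi * WK)ᵀ)

/-- Row-wise softmax of a square matrix. -/
def softmaxMat (Z : Matrix (Fin n) (Fin n) ℝ) : Matrix (Fin n) (Fin n) ℝ :=
  Matrix.of fun k j => Real.exp (Z k j) / ∑ l, Real.exp (Z k l)

/-- Softmax attention kernel. -/
def Ssoft (WQ WK : Matrix (Fin D) (Fin d) ℝ) (Xi : Matrix (Fin n) (Fin D) ℝ) :
    Matrix (Fin n) (Fin n) ℝ :=
  softmaxMat (attnC WQ WK Xi)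

/-- Gaussian attention kernel. -/
def Sgauss (WQ WK : Matrix (Fin D) (Fin d) ℝ) (Xi : Matrix (Fin n) (Fin D) ℝ) :
    Matrix (Fin n) (Fin n) ℝ :=
  Matrix.of fun k j =>
    Real.exp (-(∑ l, (Matrix.vecMul (Xi k) WQ l - Matrix.vecMul (Xi j) WK l) ^ 2) /
      (2 * Real.sqrt (d : ℝ)))

/-- Multi-head attention output on one sample, for given head kernels `S h`. -/
def MH (S : Fin H → Matrix (Fin n) (Fin n) ℝ) (WV : Fin H → Matrix (Fin D) (Fin d) ℝ)
    (WO : Fin H → Fin d → ℝ) (Xi : Matrix (Fin n) (Fin D) ℝ) : Fin n → ℝ :=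
  fun k => ∑ h, ∑ l, (S h * Xi * WV h) k l * WO h l

/-- Squared-error loss `½ Σᵢ ‖out i − y i‖²`. -/
def lossOf (out y : Fin N → Fin n → ℝ) : ℝ :=
  (1 / 2) * ∑ i, ∑ k, (out i k - y i k) ^ 2

/-- The stacked matrix `B ∈ ℝ^{Nn × HD}` whose `(i,h)` block is `S_{ih} X_i`. -/
def Bmat (S : Fin N → Fin H → Matrix (Fin n) (Fin n) ℝ)
    (X : Fin N → Matrix (Fin n) (Fin D) ℝ) :
    Matrix (Fin N × Fin n) (Fin H × Fin D) ℝ :=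
  Matrix.of fun ik hp => (S ik.1 hp.1 * X ik.1) ik.2 hp.2

/-- Block-diagonal stacked value matrix `W^V = diag(W^V_1, …, W^V_H)`. -/
def diagWV (WV : Fin H → Matrix (Fin D) (Fin d) ℝ) :
    Matrix (Fin H × Fin D) (Fin H × Fin d) ℝ :=
  Matrix.of fun hp hq => if hp.1 = hq.1 then WV hp.1 hp.2 hq.2 else 0

/-- Euclidean norm of the output weight `W^O ∈ ℝ^{Hd×1}`. -/
def WOnorm (WO : Fin H → Fin d → ℝ) : ℝ := enorm fun hl : Fin H × Fin d => WO hl.1 hl.2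

/-- Frobenius norm of the row-stacked data matrix `X ∈ ℝ^{Nn×D}`. -/
def XF (X : Fin N → Matrix (Fin n) (Fin D) ℝ) : ℝ :=
  Real.sqrt (∑ i, ∑ k, ∑ p, X i k p ^ 2)

/-- The `h`-th head matrix of a packed head-indexed parameter vector. -/
def headMat (v : EuclideanSpace ℝ (Fin H × Fin D × Fin d)) (h : Fin H) :
    Matrix (Fin D) (Fin d) ℝ :=
  Matrix.of fun p q => v (h, p, q)

/-- Index type for the full parameter set `M = (W^Q, W^K, W^V)`. -/
abbrev FullIdx (H D d : ℕ) := Fin 3 × Fin H × Fin D × Fin d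

/-- Query weights of the packed full parameter vector. -/
def mQ (v : EuclideanSpace ℝ (FullIdx H D d)) (h : Fin H) : Matrix (Fin D) (Fin d) ℝ :=
  Matrix.of fun p q => v (0, h, p, q)

/-- Key weights of the packed full parameter vector. -/
def mK (v : EuclideanSpace ℝ (FullIdx H D d)) (h : Fin H) : Matrix (Fin D) (Fin d) ℝ :=
  Matrix.of fun p q => v (1, h, p, q)

/-- Value weights of the packed full parameter vector. -/
def mV (v : EuclideanSpace ℝ (FullIdx H D d)) (h : Fin H) : Matrix (Fin D) (Fin d) ℝ :=
  Matrix.of fun p q => v (2, h, p, q)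

/-- A packed `D × d` parameter vector as a matrix. -/
def toMat2 {D d : ℕ} (w : EuclideanSpace ℝ (Fin D × Fin d)) : Matrix (Fin D) (Fin d) ℝ :=
  Matrix.of fun p q => w (p, q)

/-- The concrete value matrix `W^V = [[2a, a], [a, 2a]]` of the example. -/
def exWV (a : ℝ) : Matrix (Fin 2) (Fin 2) ℝ := !![2 * a, a; a, 2 * a]

/-- The concrete output weight `W^O = (1/a, 1/a)ᵀ` of the example (`H = 1`, `d = 2`). -/
def exWO (a : ℝ) : Fin 1 → Fin 2 → ℝ := fun _ _ => 1 / a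

/-- Model output of the example: `N = 1`, `n = D = d = 2`, `H = 1`, `X₁ = I₂`. -/
def exMH (a : ℝ) (WQ WK : Matrix (Fin 2) (Fin 2) ℝ) : Fin 2 → ℝ :=
  MH (fun _ : Fin 1 => Ssoft WQ WK (1 : Matrix (Fin 2) (Fin 2) ℝ)) (fun _ => exWV a)
    (exWO a) (1 : Matrix (Fin 2) (Fin 2) ℝ)

/-- The example loss, as a function of the (packed) query matrix only. -/
def exLoss (a : ℝ) (WK : Matrix (Fin 2) (Fin 2) ℝ) (y1 : Fin 2 → ℝ)
    (v : EuclideanSpace ℝ (Fin 2 × Fin 2)) : ℝ :=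
  lossOf (N := 1) (fun _ => exMH a (toMat2 v) WK) (fun _ => y1)

/-- The model output of the example is constantly `3`. -/
theorem exMH_eq (a : ℝ) (ha : a ≠ 0) (WQ WK : Matrix (Fin 2) (Fin 2) ℝ) :
    exMH a WQ WK = fun _ => 3 := by
  funext k
  simp only [exMH, MH, Ssoft, softmaxMat, exWV, exWO, Matrix.mul_one, Matrix.mul_apply,
    Fin.sum_univ_two, Matrix.of_apply, Finset.univ_unique, Finset.sum_singleton]
  generalize attnC WQ WK (1 : Matrix (Fin 2) (Fin 2) ℝ) = Z
  have h : Real.exp (Z k 0) + Real.exp (Z k 1) ≠ 0 := by positivity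
  simp
  field_simp
  ring

/-- the example of Section 4.2. With `X₁ = I₂`, `W^O = (1/a, 1/a)ᵀ` and
`W^V = [[2a, a],[a, 2a]]` (`a ≠ 0`), the gradient of the loss with respect to the query
weights vanishes for *every* `W^Q, W^K`; hence whenever `MH(M; X₁) ≠ y₁` the point is a
stationary point of `W^Q ↦ f(M; X₁)` with strictly positive loss. -/
theorem softmax_example_vanishing_query_gradient
    (a : ℝ) (ha : a ≠ 0) (WQ WK : Matrix (Fin 2) (Fin 2) ℝ) (y1 : Fin 2 → ℝ) :
    gradient (exLoss a WK y1)
        ((EuclideanSpace.equiv (Fin 2 × Fin 2) ℝ).symm fun pq => WQ pq.1 pq.2) = 0 ∧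
      (exMH a WQ WK ≠ y1 →
        0 < exLoss a WK y1
            ((EuclideanSpace.equiv (Fin 2 × Fin 2) ℝ).symm fun pq => WQ pq.1 pq.2)) := by
  have hc : exLoss a WK y1 = fun _ => lossOf (N := 1) (fun _ _ => 3) (fun _ => y1) := by
    funext v
    simp only [exLoss, exMH_eq a ha]
  rw [hc]
  refine ⟨by simp [gradient], fun hne => ?_⟩
  rw [exMH_eq a ha] at hne
  obtain ⟨k, hk⟩ := Function.ne_iff.mp hne
  simp only [lossOf, Finset.univ_unique, Finset.sum_singleton]
  have hk' : 0 < ((3 : ℝ) - y1 k) ^ 2 := by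
    have := sub_ne_zero.mpr hk
    positivity
  have : 0 < ∑ k, ((3 : ℝ) - y1 k) ^ 2 :=
    Finset.sum_pos' (fun i _ => sq_nonneg _) ⟨k, Finset.mem_univ k, hk'⟩
  linarith

end Paper
end
end

section
/- For the Softmax-attention kernel, the map W^Q ↦ S_i(W^Q, W^K; X_i) = [Softmax(C_{i1}), …, Softmax(C_{iH})] is Fréchet differentiable, and its differential satisfies ‖dS_i‖_F ≤ φ_i ‖dW^Q‖_F for every perturbation dW^Q of the collected query weights, where φ_i = (n/√d) ‖X_i‖_F² √(Σ_{h=1}^H σ_max²(W^K_h)). -/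
open scoped BigOperators
open scoped Matrix

noncomputable section

namespace Paper

variable {N n D d H : ℕ}

/-- Cauchy-Schwarz for a matrix-vector product. -/
lemma sum_mulVec_sq_le {m k : Type*} [Fintype m] [Fintype k] (A : Matrix m k ℝ) (u : k → ℝ) :
    ∑ i, (A.mulVec u i) ^ 2 ≤ (∑ i, ∑ j, A i j ^ 2) * ∑ j, u j ^ 2 := by
  rw [Finset.sum_mul]
  refine Finset.sum_le_sum fun i _ => ?_
  exact Finset.sum_mul_sq_le_sq_mul_sq Finset.univ (fun j => A i j) u

lemma sum_mulVec_sq_le_sigma {m k : Type*} [Fintype m] [Fintype k] (A : Matrix m k ℝ)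
    (u : k → ℝ) :
    ∑ i, (A.mulVec u i) ^ 2 ≤ sigmaMax A ^ 2 * ∑ j, u j ^ 2 := by
  have hbdd : BddAbove {c | ∃ v : k → ℝ, (∑ j, v j ^ 2) = 1 ∧ c = enorm (A.mulVec v)} := by
    refine ⟨Real.sqrt (∑ i, ∑ j, A i j ^ 2), ?_⟩
    rintro c ⟨v, hv, rfl⟩
    refine Real.sqrt_le_sqrt ?_
    have := sum_mulVec_sq_le A v
    rwa [hv, mul_one] at this
  by_cases h0 : ∑ j, u j ^ 2 = 0
  · have := sum_mulVec_sq_le A u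
    rw [h0, mul_zero] at this ⊢
    exact this
  have hpos : 0 < ∑ j, u j ^ 2 :=
    lt_of_le_of_ne (Finset.sum_nonneg fun j _ => sq_nonneg _) (Ne.symm h0)
  set r := Real.sqrt (∑ j, u j ^ 2) with hr
  have hrpos : 0 < r := Real.sqrt_pos.mpr hpos
  have hr2 : r ^ 2 = ∑ j, u j ^ 2 := Real.sq_sqrt hpos.le
  have hmem : enorm (A.mulVec (r⁻¹ • u)) ≤ sigmaMax A := by
    refine le_csSup hbdd ⟨r⁻¹ • u, ?_, rfl⟩
    simp only [Pi.smul_apply, smul_eq_mul, mul_pow]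
    rw [← Finset.mul_sum, ← hr2]
    field_simp
  have hnn : 0 ≤ enorm (A.mulVec (r⁻¹ • u)) := Real.sqrt_nonneg _
  have hsq := pow_le_pow_left₀ hnn hmem 2
  unfold enorm at hsq
  rw [Real.sq_sqrt (Finset.sum_nonneg fun j _ => sq_nonneg _), Matrix.mulVec_smul] at hsq
  simp only [Pi.smul_apply, smul_eq_mul, mul_pow] at hsq
  rw [← Finset.mul_sum] at hsq
  rw [← hr2]
  have hr2pos : 0 < r ^ 2 := by positivity
  calc ∑ i, (A.mulVec u i) ^ 2 = (r⁻¹ ^ 2 * ∑ i, (A.mulVec u i) ^ 2) * r ^ 2 := by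
        field_simp
    _ ≤ _ := by gcongr

lemma softmax_jac_le {n : ℕ} (s c : Fin n → ℝ) (hs : ∀ j, 0 ≤ s j) (hsum : ∑ j, s j = 1) :
    ∑ j, (s j * (c j - ∑ l, s l * c l)) ^ 2 ≤ ∑ j, c j ^ 2 := by
  have hs1 : ∀ j, s j ≤ 1 := fun j => by
    rw [← hsum]
    exact Finset.single_le_sum (fun i _ => hs i) (Finset.mem_univ j)
  set m := ∑ l, s l * c l with hm
  have h1 : ∑ j, (s j * (c j - m)) ^ 2 ≤ ∑ j, s j * (c j - m) ^ 2 := by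
    refine Finset.sum_le_sum fun j _ => ?_
    rw [mul_pow]
    have : s j ^ 2 ≤ s j := by nlinarith [hs j, hs1 j]
    gcongr
  have h2 : ∑ j, s j * (c j - m) ^ 2 = ∑ j, s j * c j ^ 2 - m ^ 2 := by
    have : ∀ j, s j * (c j - m) ^ 2 = s j * c j ^ 2 - 2 * m * (s j * c j) + m ^ 2 * s j :=
      fun j => by ring
    simp only [this, Finset.sum_add_distrib, Finset.sum_sub_distrib, ← Finset.mul_sum]
    rw [hsum, ← hm]
    ring
  have h3 : ∑ j, s j * c j ^ 2 ≤ ∑ j, c j ^ 2 := by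
    refine Finset.sum_le_sum fun j _ => ?_
    nlinarith [hs1 j, sq_nonneg (c j)]
  nlinarith [sq_nonneg m]

lemma attnC_sq_le {n D d : ℕ} (W K : Matrix (Fin D) (Fin d) ℝ) (X : Matrix (Fin n) (Fin D) ℝ) :
    ∑ k, ∑ j, attnC W K X k j ^ 2 ≤
      ((Real.sqrt (d : ℝ))⁻¹) ^ 2 * ((∑ k, ∑ p, X k p ^ 2) ^ 2 * sigmaMax K ^ 2 *
        ∑ p, ∑ q, W p q ^ 2) := by
  have hC : attnC W K X = (Real.sqrt (d : ℝ))⁻¹ • (X * (K * (X * W)ᵀ))ᵀ := by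
    unfold attnC
    simp only [Matrix.transpose_mul, Matrix.transpose_transpose, Matrix.mul_assoc]
  have hW : ∑ q, ∑ p, Wᵀ q p ^ 2 = ∑ p, ∑ q, W p q ^ 2 := by
    rw [Finset.sum_comm]; rfl
  have key : ∀ k, ∑ j, attnC W K X k j ^ 2 ≤ (∑ p, X k p ^ 2) *
      (((Real.sqrt (d : ℝ))⁻¹) ^ 2 * ((∑ k, ∑ p, X k p ^ 2) * sigmaMax K ^ 2 *
        ∑ p, ∑ q, W p q ^ 2)) := by
    intro k
    have e : ∀ j, attnC W K X k j =
        (Real.sqrt (d : ℝ))⁻¹ * (X.mulVec (K.mulVec (Wᵀ.mulVec (X k))) j) := by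
      intro j
      rw [hC]
      simp only [Matrix.smul_apply, smul_eq_mul, Matrix.transpose_apply]
      congr 1
      simp only [Matrix.mul_apply, Matrix.mulVec, dotProduct, Matrix.transpose_apply]
      simp only [mul_comm (W _ _)]
    simp only [e, mul_pow]
    rw [← Finset.mul_sum]
    have a1 := sum_mulVec_sq_le X (K.mulVec (Wᵀ.mulVec (X k)))
    have a2 := sum_mulVec_sq_le_sigma K (Wᵀ.mulVec (X k))
    have a3 := sum_mulVec_sq_le Wᵀ (X k)
    rw [hW] at a3
    have hX : 0 ≤ ∑ k, ∑ p, X k p ^ 2 := by positivity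
    calc _ ≤ ((Real.sqrt (d : ℝ))⁻¹) ^ 2 * ((∑ k, ∑ p, X k p ^ 2) * (sigmaMax K ^ 2 *
          ((∑ p, ∑ q, W p q ^ 2) * ∑ p, X k p ^ 2))) := by
          refine mul_le_mul_of_nonneg_left ?_ (sq_nonneg _)
          refine a1.trans (mul_le_mul_of_nonneg_left ?_ hX)
          exact a2.trans (mul_le_mul_of_nonneg_left a3 (sq_nonneg _))
      _ = _ := by ring
  refine (Finset.sum_le_sum fun k _ => key k).trans (le_of_eq ?_)
  rw [← Finset.sum_mul]
  ring

lemma attnC_line {n D d H : ℕ} (K : Matrix (Fin D) (Fin d) ℝ) (X : Matrix (Fin n) (Fin D) ℝ)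
    (v w : EuclideanSpace ℝ (Fin H × Fin D × Fin d)) (h : Fin H) (t : ℝ) (k j : Fin n) :
    attnC (headMat (v + t • w) h) K X k j =
      attnC (headMat v h) K X k j + t * attnC (headMat w h) K X k j := by
  have : headMat (v + t • w) h = headMat v h + t • headMat w h := by
    ext p q
    simp [headMat]
  rw [this]
  unfold attnC
  simp only [Matrix.mul_add, Matrix.add_mul, Matrix.mul_smul, Matrix.smul_mul,
    Matrix.add_apply, Matrix.smul_apply, smul_eq_mul]
  ring

lemma attnC_diff {n D d H : ℕ} (K : Matrix (Fin D) (Fin d) ℝ) (X : Matrix (Fin n) (Fin D) ℝ)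
    (h : Fin H) (k j : Fin n) :
    Differentiable ℝ fun v : EuclideanSpace ℝ (Fin H × Fin D × Fin d) =>
      attnC (headMat v h) K X k j := by
  unfold attnC headMat
  simp only [Matrix.smul_apply, Matrix.mul_apply, smul_eq_mul, Matrix.of_apply]
  fun_prop

lemma expsum_pos {n : ℕ} (c : Fin n → ℝ) (j : Fin n) : 0 < ∑ l, Real.exp (c l) :=
  Finset.sum_pos (fun _ _ => Real.exp_pos _) ⟨j, Finset.mem_univ j⟩

lemma softmax_line {n : ℕ} (a b : Fin n → ℝ) (j : Fin n) :
    HasDerivAt (fun t : ℝ => Real.exp (a j + t * b j) / ∑ l, Real.exp (a l + t * b l))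
      ((Real.exp (a j) / ∑ l, Real.exp (a l)) *
        (b j - ∑ l, (Real.exp (a l) / ∑ i, Real.exp (a i)) * b l)) 0 := by
  have he : ∀ l, HasDerivAt (fun t : ℝ => Real.exp (a l + t * b l)) (Real.exp (a l) * b l) 0 := by
    intro l
    have := (((hasDerivAt_id (0 : ℝ)).mul_const (b l)).const_add (a l)).exp
    simpa using this
  have hs : HasDerivAt (fun t : ℝ => ∑ l, Real.exp (a l + t * b l))
      (∑ l, Real.exp (a l) * b l) 0 := HasDerivAt.fun_sum fun l _ => he l
  have hne : ∑ l, Real.exp (a l) ≠ 0 := (expsum_pos a j).ne'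
  have := (he j).fun_div hs (by simpa using hne)
  refine this.congr_deriv ?_
  simp only [zero_mul, add_zero]
  simp only [div_mul_eq_mul_div]
  rw [← Finset.sum_div]
  field_simp

/-- Lemma 2(1) of the paper. The Softmax attention kernel
`W^Q ↦ S_i(W^Q, W^K; X_i)` is (Fréchet) differentiable, and its differential satisfies
`‖dS_i‖_F ≤ φ_i ‖dW^Q‖_F` with `φ_i = (n/√d) ‖X_i‖_F² √(Σ_h σ_max²(W^K_h))`. -/
theorem softmax_kernel_query_differential_bound
    {n D d H : ℕ}
    (Xi : Matrix (Fin n) (Fin D) ℝ)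
    (WK : Fin H → Matrix (Fin D) (Fin d) ℝ)
    (g : EuclideanSpace ℝ (Fin H × Fin D × Fin d) → EuclideanSpace ℝ (Fin n × Fin H × Fin n))
    (hg : g = fun v => (EuclideanSpace.equiv (Fin n × Fin H × Fin n) ℝ).symm
      fun khj => Ssoft (headMat v khj.2.1) (WK khj.2.1) Xi khj.1 khj.2.2) :
    Differentiable ℝ g ∧
      ∀ (v dWQ : EuclideanSpace ℝ (Fin H × Fin D × Fin d)),
        ‖fderiv ℝ g v dWQ‖ ≤
          ((n : ℝ) / Real.sqrt (d : ℝ)) * frob Xi ^ 2 *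
            Real.sqrt (∑ h, sigmaMax (WK h) ^ 2) * ‖dWQ‖ := by
  subst hg
  have hdiff : Differentiable ℝ (fun v : EuclideanSpace ℝ (Fin H × Fin D × Fin d) =>
      (EuclideanSpace.equiv (Fin n × Fin H × Fin n) ℝ).symm
      fun khj => Ssoft (headMat v khj.2.1) (WK khj.2.1) Xi khj.1 khj.2.2) := by
    refine (EuclideanSpace.equiv (Fin n × Fin H × Fin n) ℝ).symm.differentiable.comp ?_
    refine differentiable_pi.mpr fun khj => ?_
    unfold Ssoft softmaxMat
    simp only [Matrix.of_apply]
    have hC := fun l => attnC_diff (H := H) (WK khj.2.1) Xi khj.2.1 khj.1 l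
    intro v
    have h1 := (hC khj.2.2 v).exp
    have h2 : DifferentiableAt ℝ (fun v => ∑ l, Real.exp
        (attnC (headMat v khj.2.1) (WK khj.2.1) Xi khj.1 l)) v :=
      DifferentiableAt.fun_sum fun l _ => (hC l v).exp
    have h3 : ∑ l, Real.exp (attnC (headMat v khj.2.1) (WK khj.2.1) Xi khj.1 l) ≠ 0 :=
      (expsum_pos _ khj.1).ne'
    fun_prop (disch := assumption)
  refine ⟨hdiff, fun v w => ?_⟩
  set g := (fun v : EuclideanSpace ℝ (Fin H × Fin D × Fin d) =>
      (EuclideanSpace.equiv (Fin n × Fin H × Fin n) ℝ).symm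
      fun khj => Ssoft (headMat v khj.2.1) (WK khj.2.1) Xi khj.1 khj.2.2) with hg
  have hcomp : ∀ k h j, fderiv ℝ g v w (k, h, j) =
      Ssoft (headMat v h) (WK h) Xi k j * (attnC (headMat w h) (WK h) Xi k j -
        ∑ l, Ssoft (headMat v h) (WK h) Xi k l * attnC (headMat w h) (WK h) Xi k l) := by
    intro k h j
    have h1 : HasDerivAt (fun t : ℝ => g (v + t • w)) (fderiv ℝ g v w) 0 := by
      have hl : HasDerivAt (fun t : ℝ => v + t • w) w 0 := by
        simpa using ((hasDerivAt_id (0 : ℝ)).smul_const w).const_add v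
      have hgd : HasFDerivAt g (fderiv ℝ g v) (v + (0 : ℝ) • w) := by
        simpa using (hdiff v).hasFDerivAt
      exact hgd.comp_hasDerivAt (0 : ℝ) hl
    have h2 : HasDerivAt (fun t : ℝ => g (v + t • w) (k, h, j)) (fderiv ℝ g v w (k, h, j)) 0 :=
      (EuclideanSpace.proj (𝕜 := ℝ) (k, h, j)).hasFDerivAt.comp_hasDerivAt (0 : ℝ) h1
    have h3 := softmax_line (fun l => attnC (headMat v h) (WK h) Xi k l)
      (fun l => attnC (headMat w h) (WK h) Xi k l) j
    have h4 : (fun t : ℝ => g (v + t • w) (k, h, j)) = fun t : ℝ =>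
        Real.exp (attnC (headMat v h) (WK h) Xi k j + t * attnC (headMat w h) (WK h) Xi k j) /
        ∑ l, Real.exp (attnC (headMat v h) (WK h) Xi k l +
          t * attnC (headMat w h) (WK h) Xi k l) := by
      funext t
      simp only [← attnC_line]
      rfl
    rw [h4] at h2
    exact h2.unique h3
  have hrow : ∀ k h, ∑ j, (fderiv ℝ g v w (k, h, j)) ^ 2 ≤
      ∑ j, attnC (headMat w h) (WK h) Xi k j ^ 2 := by
    intro k h
    simp only [hcomp]
    refine softmax_jac_le (fun j => Ssoft (headMat v h) (WK h) Xi k j)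
      (fun j => attnC (headMat w h) (WK h) Xi k j) (fun j => ?_) ?_
    · exact div_nonneg (Real.exp_pos _).le (expsum_pos _ k).le
    · simp only [Ssoft, softmaxMat, Matrix.of_apply]
      rw [← Finset.sum_div]
      exact div_self (expsum_pos _ k).ne'
  rcases Nat.eq_zero_or_pos n with hn | hn
  · subst hn
    have : fderiv ℝ g v w = 0 := by
      ext x
      exact x.1.elim0
    rw [this, norm_zero]
    simp
  have hn1 : (1 : ℝ) ≤ n := by exact_mod_cast hn
  have hX : frob Xi ^ 2 = ∑ k, ∑ p, Xi k p ^ 2 := Real.sq_sqrt (by positivity)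
  have hS : Real.sqrt (∑ h, sigmaMax (WK h) ^ 2) ^ 2 = ∑ h, sigmaMax (WK h) ^ 2 :=
    Real.sq_sqrt (by positivity)
  have hw : ‖w‖ ^ 2 = ∑ h, ∑ p, ∑ q, headMat w h p q ^ 2 := by
    rw [EuclideanSpace.real_norm_sq_eq]
    simp only [Fintype.sum_prod_type]
    rfl
  refine (sq_le_sq₀ (norm_nonneg _) (by positivity)).mp ?_
  have hL : ‖fderiv ℝ g v w‖ ^ 2 = ∑ h, ∑ k, ∑ j, (fderiv ℝ g v w (k, h, j)) ^ 2 := by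
    rw [EuclideanSpace.real_norm_sq_eq]
    simp only [Fintype.sum_prod_type]
    rw [Finset.sum_comm]
  rw [hL]
  have hbound : ∑ h, ∑ k, ∑ j, (fderiv ℝ g v w (k, h, j)) ^ 2 ≤
      ∑ h, ((Real.sqrt (d : ℝ))⁻¹) ^ 2 * (frob Xi ^ 2) ^ 2 * (sigmaMax (WK h) ^ 2 * ‖w‖ ^ 2) := by
    refine Finset.sum_le_sum fun h _ => ?_
    refine (Finset.sum_le_sum fun k _ => hrow k h).trans ?_
    refine (attnC_sq_le _ _ _).trans ?_
    have hle : ∑ p, ∑ q, headMat w h p q ^ 2 ≤ ‖w‖ ^ 2 := by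
      rw [hw]
      exact Finset.single_le_sum (f := fun h => ∑ p, ∑ q, headMat w h p q ^ 2)
        (fun i _ => by positivity) (Finset.mem_univ h)
    rw [← hX, mul_assoc, mul_assoc]
    gcongr
  refine hbound.trans ?_
  rw [← Finset.mul_sum, ← Finset.sum_mul, div_eq_mul_inv]
  generalize Real.sqrt (∑ h, sigmaMax (WK h) ^ 2) = r at hS ⊢
  rw [← hS]
  have hn2 : (1 : ℝ) ≤ (n : ℝ) ^ 2 := one_le_pow₀ hn1
  have hnn : 0 ≤ ((Real.sqrt (d : ℝ))⁻¹) ^ 2 * (frob Xi ^ 2) ^ 2 *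
      (r ^ 2 * ‖w‖ ^ 2) := by positivity
  calc _ ≤ (n : ℝ) ^ 2 * (((Real.sqrt (d : ℝ))⁻¹) ^ 2 * (frob Xi ^ 2) ^ 2 *
      (r ^ 2 * ‖w‖ ^ 2)) := le_mul_of_one_le_left hnn hn2
    _ = _ := by ring

end Paper
end
end

section
/- For the Softmax-attention Transformer, on any region of parameter space where σ_max(W^Q_h), σ_max(W^K_h) (for all h) and σ_max(W^V) are bounded by a fixed constant R, the map M ↦ MH(M; X) is Lipschitz: there exists a constant Z > 0 (depending only on the data X, y, W^O, N, n, H, d and R) such that for any two parameter sets M, M′ in this region, ‖MH(M; X) − MH(M′; X)‖_F ≤ Z ‖M − M′‖_F. Explicitly, one may take Z = N √(max_i Q_i² + max_i K_i² + n² H max_i ‖X_i‖_F² ‖W^O‖₂²), with Q_i, K_i as the per-sample gradient bounds Q_i = n√H‖X_i‖_F³‖W^O‖₂√(Σ_h σ_max²(W^K_h))σ_max(W^V) and K_i = n√H‖X_i‖_F³‖W^O‖₂√(Σ_h σ_max²(W^Q_h))σ_max(W^V) evaluated with the bound R. -/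
open scoped BigOperators
open scoped Matrix

noncomputable section

namespace Paper

variable {N n D d H : ℕ}

lemma enorm_nn {ι : Type*} [Fintype ι] (v : ι → ℝ) : 0 ≤ enorm v := Real.sqrt_nonneg _

lemma enorm_sq' {ι : Type*} [Fintype ι] (v : ι → ℝ) : enorm v ^ 2 = ∑ i, v i ^ 2 :=
  Real.sq_sqrt (Finset.sum_nonneg fun i _ => sq_nonneg _)

lemma frob_nn {m k : Type*} [Fintype m] [Fintype k] (A : Matrix m k ℝ) : 0 ≤ frob A :=
  Real.sqrt_nonneg _

lemma frob_sq' {m k : Type*} [Fintype m] [Fintype k] (A : Matrix m k ℝ) :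
    frob A ^ 2 = ∑ i, ∑ j, A i j ^ 2 :=
  Real.sq_sqrt (Finset.sum_nonneg fun i _ => Finset.sum_nonneg fun j _ => sq_nonneg _)

lemma frob_sq_rows {m k : Type*} [Fintype m] [Fintype k] (A : Matrix m k ℝ) :
    frob A ^ 2 = ∑ i, enorm (A i) ^ 2 := by
  rw [frob_sq']; simp only [enorm_sq']

lemma cs_abs {ι : Type*} [Fintype ι] (a b : ι → ℝ) :
    |∑ i, a i * b i| ≤ enorm a * enorm b := by
  apply abs_le_of_sq_le_sq _ (mul_nonneg (enorm_nn _) (enorm_nn _))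
  rw [mul_pow, enorm_sq', enorm_sq']
  exact Finset.sum_mul_sq_le_sq_mul_sq _ _ _

lemma enorm_le_of {ι : Type*} [Fintype ι] (v : ι → ℝ) (c : ℝ) (hc : 0 ≤ c)
    (h : ∑ i, v i ^ 2 ≤ c ^ 2) : enorm v ≤ c := by
  apply abs_le_of_sq_le_sq' _ hc |>.2
  rw [enorm_sq']; exact h

lemma abs_le_enorm {ι : Type*} [Fintype ι] (v : ι → ℝ) (i : ι) : |v i| ≤ enorm v := by
  apply abs_le_of_sq_le_sq _ (enorm_nn _)
  rw [enorm_sq']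
  exact Finset.single_le_sum (f := fun i => v i ^ 2) (fun i _ => sq_nonneg _) (Finset.mem_univ i)

lemma row_le_frob {m k : Type*} [Fintype m] [Fintype k] (A : Matrix m k ℝ) (i : m) :
    enorm (A i) ≤ frob A := by
  apply enorm_le_of _ _ (frob_nn _)
  rw [frob_sq']
  exact Finset.single_le_sum (f := fun i => ∑ j, A i j ^ 2)
    (fun i _ => Finset.sum_nonneg fun j _ => sq_nonneg _) (Finset.mem_univ i)

lemma mulVec_frob {m k : Type*} [Fintype m] [Fintype k] (A : Matrix m k ℝ) (v : k → ℝ) :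
    enorm (A.mulVec v) ≤ frob A * enorm v := by
  apply enorm_le_of _ _ (mul_nonneg (frob_nn _) (enorm_nn _))
  rw [mul_pow, frob_sq_rows, Finset.sum_mul]
  apply Finset.sum_le_sum
  intro i _
  rw [← mul_pow]
  exact sq_le_sq' (abs_le.1 (cs_abs (A i) v)).1 (abs_le.1 (cs_abs (A i) v)).2

lemma frob_transpose {m k : Type*} [Fintype m] [Fintype k] (A : Matrix m k ℝ) :
    frob Aᵀ = frob A := by
  unfold frob
  rw [Finset.sum_comm]
  rfl

lemma vecMul_frob {m k : Type*} [Fintype m] [Fintype k] (A : Matrix m k ℝ) (u : m → ℝ) :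
    enorm (Matrix.vecMul u A) ≤ enorm u * frob A := by
  rw [← Matrix.mulVec_transpose, mul_comm, ← frob_transpose]
  exact mulVec_frob _ _

lemma enorm_smul' {ι : Type*} [Fintype ι] (c : ℝ) (v : ι → ℝ) :
    enorm (c • v) = |c| * enorm v := by
  unfold enorm
  rw [← Real.sqrt_sq_eq_abs, ← Real.sqrt_mul (sq_nonneg c), Finset.mul_sum]
  simp [mul_pow]

lemma sigmaMax_nn {m k : Type*} [Fintype m] [Fintype k] (A : Matrix m k ℝ) :
    0 ≤ sigmaMax A := by
  apply Real.sSup_nonneg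
  rintro c ⟨v, _, rfl⟩
  exact enorm_nn _

lemma mulVec_sigma {m k : Type*} [Fintype m] [Fintype k] (A : Matrix m k ℝ) (v : k → ℝ) :
    enorm (A.mulVec v) ≤ sigmaMax A * enorm v := by
  by_cases h0 : enorm v = 0
  · have := mulVec_frob A v
    rw [h0] at this ⊢
    simpa using this
  have hpos : 0 < enorm v := lt_of_le_of_ne (enorm_nn _) (Ne.symm h0)
  have hb : BddAbove {c | ∃ v : k → ℝ, (∑ j, v j ^ 2) = 1 ∧ c = enorm (A.mulVec v)} := by
    refine ⟨frob A, ?_⟩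
    rintro c ⟨w, hw, rfl⟩
    have := mulVec_frob A w
    have h1 : enorm w = 1 := by unfold enorm; rw [hw]; simp
    rw [h1] at this
    simpa using this
  have key : enorm (A.mulVec ((enorm v)⁻¹ • v)) ≤ sigmaMax A := by
    apply le_csSup hb
    refine ⟨_, ?_, rfl⟩
    rw [← enorm_sq', enorm_smul', abs_of_pos (inv_pos.2 hpos), inv_mul_cancel₀ h0]
    norm_num
  rw [Matrix.mulVec_smul, enorm_smul', abs_of_pos (inv_pos.2 hpos)] at key
  rwa [inv_mul_le_iff₀ hpos, mul_comm] at key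

lemma vecMul_sigma {m k : Type*} [Fintype m] [Fintype k] (A : Matrix m k ℝ) (u : m → ℝ)
    (R : ℝ) (hR : sigmaMax A ≤ R) :
    enorm (Matrix.vecMul u A) ≤ R * enorm u := by
  have hR0 := (sigmaMax_nn A).trans hR
  set w := Matrix.vecMul u A with hw
  have h1 : enorm w ^ 2 = ∑ i, u i * (A.mulVec w) i := by
    have : w ⬝ᵥ w = u ⬝ᵥ (A.mulVec w) := by
      rw [Matrix.dotProduct_mulVec]
    rw [enorm_sq']
    simpa [dotProduct, sq] using this
  have h2 : enorm w ^ 2 ≤ enorm u * (R * enorm w) := by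
    rw [h1]
    refine (le_abs_self _).trans ((cs_abs _ _).trans ?_)
    gcongr
    · exact enorm_nn _
    · exact (mulVec_sigma A w).trans (mul_le_mul_of_nonneg_right hR (enorm_nn _))
  rcases (enorm_nn w).eq_or_lt with h | h
  · rw [← h]; exact mul_nonneg hR0 (enorm_nn _)
  · have : enorm w * enorm w ≤ (R * enorm u) * enorm w := by nlinarith
    exact le_of_mul_le_mul_right this h

/-- Covariance bound. -/
lemma cov_bound {ι : Type*} [Fintype ι] (s a z : ι → ℝ) (hs : ∀ i, 0 ≤ s i)
    (h1 : ∑ i, s i = 1) :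
    |(∑ i, s i * a i * z i) - (∑ i, s i * a i) * (∑ i, s i * z i)| ≤ enorm a * enorm z := by
  have hs1 : ∀ i, s i ≤ 1 := fun i => by
    rw [← h1]; exact Finset.single_le_sum (fun i _ => hs i) (Finset.mem_univ i)
  set m := ∑ i, s i * a i with hm
  have e : (∑ i, s i * a i * z i) - m * (∑ i, s i * z i) = ∑ i, s i * (a i - m) * z i := by
    rw [Finset.mul_sum, ← Finset.sum_sub_distrib]
    exact Finset.sum_congr rfl fun i _ => by ring
  rw [e]
  apply abs_le_of_sq_le_sq _ (mul_nonneg (enorm_nn _) (enorm_nn _))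
  have c := Finset.sum_sq_le_sum_mul_sum_of_sq_eq_mul Finset.univ
    (r := fun i => s i * (a i - m) * z i) (f := fun i => s i * (a i - m) ^ 2)
    (g := fun i => s i * z i ^ 2)
    (fun i _ => mul_nonneg (hs i) (sq_nonneg _)) (fun i _ => mul_nonneg (hs i) (sq_nonneg _))
    (fun i _ => by ring)
  refine c.trans ?_
  rw [mul_pow, enorm_sq', enorm_sq']
  have e2 : ∑ i, s i * (a i - m) ^ 2 = (∑ i, s i * a i ^ 2) - m ^ 2 := by
    have : ∀ i, s i * (a i - m) ^ 2 = s i * a i ^ 2 - 2 * m * (s i * a i) + m ^ 2 * s i :=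
      fun i => by ring
    simp only [this, Finset.sum_add_distrib, Finset.sum_sub_distrib, ← Finset.mul_sum, h1, ← hm]
    ring
  have hle : ∀ b : ι → ℝ, ∑ i, s i * b i ^ 2 ≤ ∑ i, b i ^ 2 := fun b =>
    Finset.sum_le_sum fun i _ => mul_le_of_le_one_left (sq_nonneg _) (hs1 i)
  apply mul_le_mul
  · rw [e2]; nlinarith [hle a, sq_nonneg m]
  · exact hle z
  · exact Finset.sum_nonneg fun i _ => mul_nonneg (hs i) (sq_nonneg _)
  · exact Finset.sum_nonneg fun i _ => sq_nonneg _

lemma softmax_lip {n : ℕ} [NeZero n] (c c' z : Fin n → ℝ) :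
    |(∑ j, Real.exp (c j) / (∑ l, Real.exp (c l)) * z j) -
      ∑ j, Real.exp (c' j) / (∑ l, Real.exp (c' l)) * z j| ≤
      enorm (fun j => c j - c' j) * enorm z := by
  set a : Fin n → ℝ := fun j => c j - c' j with ha
  let E : ℝ → Fin n → ℝ := fun t j => Real.exp (c' j + t * a j)
  let P : ℝ → ℝ := fun t => ∑ l, E t l
  have hP : ∀ t, 0 < P t := fun t =>
    Finset.sum_pos (fun l _ => Real.exp_pos _) Finset.univ_nonempty
  let g : ℝ → ℝ := fun t => (∑ j, E t j * z j) / P t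
  have hE : ∀ t j, HasDerivAt (fun t => E t j) (E t j * a j) t := fun t j => by
    have h := (((hasDerivAt_id t).mul_const (a j)).const_add (c' j)).exp
    simpa using h
  have hg : ∀ t, HasDerivAt g (((∑ j, E t j * a j * z j) * P t -
      (∑ j, E t j * z j) * (∑ j, E t j * a j)) / P t ^ 2) t := fun t => by
    have h1 : HasDerivAt (fun t => ∑ j, E t j * z j) (∑ j, E t j * a j * z j) t :=
      HasDerivAt.fun_sum fun j _ => (hE t j).mul_const _
    have h2 : HasDerivAt P (∑ j, E t j * a j) t :=
      HasDerivAt.fun_sum fun j _ => hE t j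
    exact h1.div h2 (hP t).ne'
  have hbound : ∀ t, ‖((∑ j, E t j * a j * z j) * P t -
      (∑ j, E t j * z j) * (∑ j, E t j * a j)) / P t ^ 2‖ ≤ enorm a * enorm z := fun t => by
    have h := cov_bound (fun j => E t j / P t) a z
      (fun j => div_nonneg (Real.exp_pos _).le (hP t).le)
      (by rw [← Finset.sum_div]; exact div_self (hP t).ne')
    rw [Real.norm_eq_abs]
    convert h using 2
    have q1 : ∑ i, E t i / P t * a i * z i = (∑ i, E t i * a i * z i) / P t := by
      rw [Finset.sum_div]; exact Finset.sum_congr rfl fun i _ => by ring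
    have q2 : ∑ i, E t i / P t * a i = (∑ i, E t i * a i) / P t := by
      rw [Finset.sum_div]; exact Finset.sum_congr rfl fun i _ => by ring
    have q3 : ∑ i, E t i / P t * z i = (∑ i, E t i * z i) / P t := by
      rw [Finset.sum_div]; exact Finset.sum_congr rfl fun i _ => by ring
    rw [q1, q2, q3]
    have := (hP t).ne'
    field_simp
  have mv := norm_image_sub_le_of_norm_deriv_le_segment_01' (f := g)
    (fun t _ => (hg t).hasDerivWithinAt) (fun t _ => hbound t)
  have q : ∀ t, g t = ∑ j, E t j / P t * z j := fun t => by
    simp only [g]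
    rw [Finset.sum_div]; exact Finset.sum_congr rfl fun i _ => by ring
  rw [q, q, Real.norm_eq_abs] at mv
  simpa [E, P, ha] using mv

lemma bil_bound {D d : ℕ} (Q K Q' K' : Matrix (Fin D) (Fin d) ℝ) (x y : Fin D → ℝ) (R : ℝ)
    (hK : sigmaMax K ≤ R) (hQ' : sigmaMax Q' ≤ R) :
    |(∑ l, Matrix.vecMul x Q l * Matrix.vecMul y K l) -
      ∑ l, Matrix.vecMul x Q' l * Matrix.vecMul y K' l| ≤
      enorm x * enorm y * (R * (frob (Q - Q') + frob (K - K'))) := by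
  have e : (∑ l, Matrix.vecMul x Q l * Matrix.vecMul y K l) -
      ∑ l, Matrix.vecMul x Q' l * Matrix.vecMul y K' l =
      (∑ l, Matrix.vecMul x (Q - Q') l * Matrix.vecMul y K l) +
      ∑ l, Matrix.vecMul x Q' l * Matrix.vecMul y (K - K') l := by
    rw [← Finset.sum_sub_distrib, ← Finset.sum_add_distrib]
    refine Finset.sum_congr rfl fun l _ => ?_
    simp only [Matrix.vecMul_sub, Pi.sub_apply]
    ring
  rw [e]
  have hx := enorm_nn x
  have hy := enorm_nn y
  have a1 : |∑ l, Matrix.vecMul x (Q - Q') l * Matrix.vecMul y K l| ≤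
      (enorm x * frob (Q - Q')) * (R * enorm y) :=
    (cs_abs _ _).trans (mul_le_mul (vecMul_frob _ _) (vecMul_sigma _ _ _ hK) (enorm_nn _)
      (mul_nonneg hx (frob_nn _)))
  have a2 : |∑ l, Matrix.vecMul x Q' l * Matrix.vecMul y (K - K') l| ≤
      (R * enorm x) * (enorm y * frob (K - K')) :=
    (cs_abs _ _).trans (mul_le_mul (vecMul_sigma _ _ _ hQ') (vecMul_frob _ _) (enorm_nn _)
      (mul_nonneg ((sigmaMax_nn _).trans hQ') hx))
  refine (abs_add_le _ _).trans ((add_le_add a1 a2).trans (le_of_eq ?_))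
  ring

lemma attnC_apply {n D d : ℕ} (Q K : Matrix (Fin D) (Fin d) ℝ) (Xi : Matrix (Fin n) (Fin D) ℝ)
    (k j : Fin n) : attnC Q K Xi k j = (Real.sqrt (d : ℝ))⁻¹ *
      ∑ l, Matrix.vecMul (Xi k) Q l * Matrix.vecMul (Xi j) K l := by
  simp only [attnC, Matrix.smul_apply, smul_eq_mul, Matrix.mul_apply, Matrix.transpose_apply,
    Matrix.vecMul, dotProduct]

lemma inv_sqrt_le (d : ℕ) : |(Real.sqrt (d : ℝ))⁻¹| ≤ 1 := by
  rw [abs_of_nonneg (inv_nonneg.2 (Real.sqrt_nonneg _))]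
  rcases Nat.eq_zero_or_pos d with h | h
  · simp [h]
  · apply inv_le_one_of_one_le₀
    rw [Real.one_le_sqrt]
    exact_mod_cast h

lemma attn_row {n D d : ℕ} (Q K Q' K' : Matrix (Fin D) (Fin d) ℝ)
    (Xi : Matrix (Fin n) (Fin D) ℝ) (R : ℝ)
    (hK : sigmaMax K ≤ R) (hQ' : sigmaMax Q' ≤ R) (k : Fin n) :
    enorm (fun j => attnC Q K Xi k j - attnC Q' K' Xi k j) ≤
      frob Xi ^ 2 * (R * (frob (Q - Q') + frob (K - K'))) := by
  have hR0 := (sigmaMax_nn _).trans hK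
  set B := R * (frob (Q - Q') + frob (K - K')) with hB
  have hB0 : 0 ≤ B := mul_nonneg hR0 (add_nonneg (frob_nn _) (frob_nn _))
  have hX := frob_nn Xi
  apply enorm_le_of _ _ (by positivity)
  have e : (frob Xi ^ 2 * B) ^ 2 = ∑ j, (frob Xi * enorm (Xi j) * B) ^ 2 := by
    have : ∀ j, (frob Xi * enorm (Xi j) * B) ^ 2 = (frob Xi * B) ^ 2 * enorm (Xi j) ^ 2 :=
      fun j => by ring
    simp only [this, ← Finset.mul_sum, ← frob_sq_rows]
    ring
  rw [e]
  refine Finset.sum_le_sum fun j _ => ?_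
  apply sq_le_sq.2
  rw [abs_of_nonneg (mul_nonneg (mul_nonneg hX (enorm_nn _)) hB0), attnC_apply, attnC_apply,
    ← mul_sub, abs_mul]
  have b := bil_bound Q K Q' K' (Xi k) (Xi j) R hK hQ'
  calc _ ≤ 1 * (enorm (Xi k) * enorm (Xi j) * B) :=
        mul_le_mul (inv_sqrt_le d) b (abs_nonneg _) zero_le_one
    _ ≤ _ := by
        rw [one_mul]
        have := enorm_nn (Xi j)
        gcongr
        exact row_le_frob _ _

/-- Single row bound for one head. -/
lemma head_bound {n D d : ℕ} (Q K V Q' K' V' : Matrix (Fin D) (Fin d) ℝ) (w : Fin d → ℝ)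
    (Xi : Matrix (Fin n) (Fin D) ℝ) (R : ℝ)
    (hK : sigmaMax K ≤ R) (hQ' : sigmaMax Q' ≤ R) (k : Fin n) :
    |(∑ l, (Ssoft Q K Xi * Xi * V) k l * w l) - ∑ l, (Ssoft Q' K' Xi * Xi * V') k l * w l| ≤
      frob Xi ^ 3 * R * ((frob (Q - Q') + frob (K - K')) * enorm (V.mulVec w)) +
      frob Xi * (frob (V - V') * enorm w) := by
  haveI : NeZero n := ⟨by rintro rfl; exact k.elim0⟩
  have hR0 := (sigmaMax_nn _).trans hK
  have hX := frob_nn Xi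
  have r : ∀ (S : Matrix (Fin n) (Fin n) ℝ) (V : Matrix (Fin D) (Fin d) ℝ),
      ∑ l, (S * Xi * V) k l * w l = ∑ j, S k j * (Xi.mulVec (V.mulVec w)) j := by
    intro S V
    change ((S * Xi * V).mulVec w) k = (S.mulVec (Xi.mulVec (V.mulVec w))) k
    rw [Matrix.mulVec_mulVec, Matrix.mulVec_mulVec, Matrix.mul_assoc]
  rw [r, r]
  set z := Xi.mulVec (V.mulVec w) with hz
  set S' := Ssoft Q' K' Xi with hS'
  have e : (∑ j, Ssoft Q K Xi k j * z j) - ∑ j, S' k j * (Xi.mulVec (V'.mulVec w)) j =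
      ((∑ j, Ssoft Q K Xi k j * z j) - ∑ j, S' k j * z j) +
      ∑ j, S' k j * (Xi.mulVec ((V - V').mulVec w)) j := by
    rw [Matrix.sub_mulVec, Matrix.mulVec_sub]
    simp only [Pi.sub_apply, mul_sub, Finset.sum_sub_distrib]
    ring
  rw [e]
  refine (abs_add_le _ _).trans (add_le_add ?_ ?_)
  · have h := softmax_lip (attnC Q K Xi k) (attnC Q' K' Xi k) z
    refine (show _ ≤ _ from h).trans ?_
    have h1 := attn_row Q K Q' K' Xi R hK hQ' k
    have h2 : enorm z ≤ frob Xi * enorm (V.mulVec w) := mulVec_frob _ _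
    refine (mul_le_mul h1 h2 (enorm_nn _) ?_).trans (le_of_eq (by ring))
    exact mul_nonneg (by positivity) (mul_nonneg hR0 (add_nonneg (frob_nn _) (frob_nn _)))
  · set y := Xi.mulVec ((V - V').mulVec w) with hy
    have hpos : ∀ j, 0 ≤ S' k j := fun j =>
      div_nonneg (Real.exp_pos _).le (Finset.sum_nonneg fun _ _ => (Real.exp_pos _).le)
    have hsum : ∑ j, S' k j = 1 := by
      change ∑ j, Real.exp _ / _ = 1
      rw [← Finset.sum_div]
      exact div_self (Finset.sum_pos (fun l _ => Real.exp_pos _) Finset.univ_nonempty).ne'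
    have h3 : enorm y ≤ frob Xi * (frob (V - V') * enorm w) :=
      (mulVec_frob _ _).trans (mul_le_mul_of_nonneg_left (mulVec_frob _ _) hX)
    calc |∑ j, S' k j * y j| ≤ ∑ j, |S' k j * y j| := Finset.abs_sum_le_sum_abs _ _
      _ ≤ ∑ j, S' k j * enorm y := Finset.sum_le_sum fun j _ => by
          rw [abs_mul, abs_of_nonneg (hpos j)]
          exact mul_le_mul_of_nonneg_left (abs_le_enorm _ _) (hpos j)
      _ = enorm y := by rw [← Finset.sum_mul, hsum, one_mul]
      _ ≤ _ := h3

lemma diag_bound {D d H : ℕ} (V : Fin H → Matrix (Fin D) (Fin d) ℝ) (WO : Fin H → Fin d → ℝ)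
    (R : ℝ) (hV : sigmaMax (diagWV V) ≤ R) :
    enorm (fun h => enorm ((V h).mulVec (WO h))) ≤ R * WOnorm WO := by
  have h := (mulVec_sigma (diagWV V) (fun hl => WO hl.1 hl.2)).trans
    (mul_le_mul_of_nonneg_right hV (enorm_nn _))
  refine le_trans (le_of_eq ?_) h
  unfold enorm
  congr 1
  rw [Fintype.sum_prod_type]
  refine Finset.sum_congr rfl fun h _ => ?_
  rw [Real.sq_sqrt (Finset.sum_nonneg fun i _ => sq_nonneg _)]
  refine Finset.sum_congr rfl fun p _ => ?_
  congr 1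
  simp [Matrix.mulVec, dotProduct, diagWV, Fintype.sum_prod_type]

lemma WO_enorm {d H : ℕ} (WO : Fin H → Fin d → ℝ) :
    enorm (fun h => enorm (WO h)) = WOnorm WO := by
  unfold WOnorm enorm
  congr 1
  rw [Fintype.sum_prod_type]
  refine Finset.sum_congr rfl fun h _ => ?_
  rw [Real.sq_sqrt (Finset.sum_nonneg fun i _ => sq_nonneg _)]

lemma sample_bound {n D d H : ℕ} (Xi : Matrix (Fin n) (Fin D) ℝ)
    (WO : Fin H → Fin d → ℝ) (R : ℝ) (Q K V Q' K' V' : Fin H → Matrix (Fin D) (Fin d) ℝ)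
    (hK : ∀ h, sigmaMax (K h) ≤ R) (hQ' : ∀ h, sigmaMax (Q' h) ≤ R)
    (hV : sigmaMax (diagWV V) ≤ R) (k : Fin n) :
    |MH (fun h => Ssoft (Q h) (K h) Xi) V WO Xi k -
      MH (fun h => Ssoft (Q' h) (K' h) Xi) V' WO Xi k| ≤
      frob Xi ^ 3 * R * ((enorm (fun h => frob (Q h - Q' h)) + enorm (fun h => frob (K h - K' h)))
        * (R * WOnorm WO)) +
      frob Xi * (enorm (fun h => frob (V h - V' h)) * WOnorm WO) := by
  have hR0 := (sigmaMax_nn _).trans hV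
  have hX := frob_nn Xi
  unfold MH
  rw [← Finset.sum_sub_distrib]
  refine (Finset.abs_sum_le_sum_abs _ _).trans ((Finset.sum_le_sum fun h _ =>
    head_bound (Q h) (K h) (V h) (Q' h) (K' h) (V' h) (WO h) Xi R (hK h) (hQ' h) k).trans ?_)
  rw [Finset.sum_add_distrib, ← Finset.mul_sum, ← Finset.mul_sum]
  simp only [add_mul, Finset.sum_add_distrib]
  have db := diag_bound V WO R hV
  have c1 : ∀ A : Fin H → Matrix (Fin D) (Fin d) ℝ,
      ∑ h, frob (A h) * enorm ((V h).mulVec (WO h)) ≤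
      enorm (fun h => frob (A h)) * (R * WOnorm WO) := fun A =>
    (le_abs_self _).trans ((cs_abs (fun h => frob (A h)) (fun h => enorm ((V h).mulVec (WO h)))).trans
      (mul_le_mul_of_nonneg_left db (enorm_nn _)))
  have c2 : ∑ h, frob (V h - V' h) * enorm (WO h) ≤
      enorm (fun h => frob (V h - V' h)) * WOnorm WO := by
    rw [← WO_enorm]
    exact (le_abs_self _).trans (cs_abs (fun h => frob (V h - V' h)) (fun h => enorm (WO h)))
  gcongr
  · exact c1 fun h => Q h - Q' h
  · exact c1 fun h => K h - K' h

lemma norm_split {D d H : ℕ} (v v' : EuclideanSpace ℝ (FullIdx H D d)) :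
    ‖v - v'‖ ^ 2 = enorm (fun h => frob (mQ v h - mQ v' h)) ^ 2 +
      enorm (fun h => frob (mK v h - mK v' h)) ^ 2 +
      enorm (fun h => frob (mV v h - mV v' h)) ^ 2 := by
  simp only [EuclideanSpace.norm_sq_eq, enorm_sq', frob_sq', Fintype.sum_prod_type,
    Fin.sum_univ_three, mQ, mK, mV, Matrix.sub_apply, Matrix.of_apply, Real.norm_eq_abs, sq_abs,
    PiLp.sub_apply]

lemma cs3 (a b q k v : ℝ) :
    (a * (q + k) + b * v) ^ 2 ≤ (a ^ 2 + a ^ 2 + b ^ 2) * (q ^ 2 + k ^ 2 + v ^ 2) := by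
  nlinarith [sq_nonneg (a * (q - k)), sq_nonneg (a * v - b * q), sq_nonneg (a * v - b * k)]

/-- Lemma 3(1) of the paper. On a region where all singular values of
`W^Q_h`, `W^K_h` and `W^V` are bounded by `R`, the Softmax-attention Transformer output
`M ↦ MH(M;X)` is `Z`-Lipschitz with the explicit constant
`Z = N √(maxᵢ Qᵢ² + maxᵢ Kᵢ² + n²H maxᵢ ‖Xᵢ‖_F² ‖W^O‖₂²)`
(`Qᵢ, Kᵢ` evaluated with the bound `R`). -/
theorem softmax_output_lipschitz
    {N n D d H : ℕ}
    (X : Fin N → Matrix (Fin n) (Fin D) ℝ)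
    (WO : Fin H → Fin d → ℝ)
    (R : ℝ)
    (Z : ℝ)
    (hZ : Z = N * Real.sqrt (
        (⨆ i, (n * Real.sqrt (H : ℝ) * frob (X i) ^ 3 * WOnorm WO *
          Real.sqrt (∑ _h : Fin H, R ^ 2) * R) ^ 2) +
        (⨆ i, (n * Real.sqrt (H : ℝ) * frob (X i) ^ 3 * WOnorm WO *
          Real.sqrt (∑ _h : Fin H, R ^ 2) * R) ^ 2) +
        n ^ 2 * H * (⨆ i, frob (X i) ^ 2) * WOnorm WO ^ 2)) :
    ∀ v v' : EuclideanSpace ℝ (FullIdx H D d),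
      (∀ h, sigmaMax (mQ v h) ≤ R) → (∀ h, sigmaMax (mK v h) ≤ R) →
      sigmaMax (diagWV (mV v)) ≤ R →
      (∀ h, sigmaMax (mQ v' h) ≤ R) → (∀ h, sigmaMax (mK v' h) ≤ R) →
      sigmaMax (diagWV (mV v')) ≤ R →
      enorm (fun ik : Fin N × Fin n =>
          MH (fun h => Ssoft (mQ v h) (mK v h) (X ik.1)) (mV v) WO (X ik.1) ik.2 -
            MH (fun h => Ssoft (mQ v' h) (mK v' h) (X ik.1)) (mV v') WO (X ik.1) ik.2) ≤
        Z * ‖v - v'‖ := by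
  intro v v' _ hK hV hQ' _ _
  have hR0 : 0 ≤ R := (sigmaMax_nn _).trans hV
  have hZ0 : 0 ≤ Z := by rw [hZ]; positivity
  have hW : 0 ≤ WOnorm WO := enorm_nn _
  apply enorm_le_of _ _ (mul_nonneg hZ0 (norm_nonneg _))
  rcases Nat.eq_zero_or_pos H with hH | hH
  · subst hH
    simp only [MH, Finset.univ_eq_empty, Finset.sum_empty, sub_zero]
    simp only [ne_eq, OfNat.ofNat_ne_zero, not_false_eq_true, zero_pow, Finset.sum_const_zero]
    positivity
  have hH1 : (1 : ℝ) ≤ H := by exact_mod_cast hH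
  set F : Fin N → ℝ := fun i => (n * Real.sqrt (H : ℝ) * frob (X i) ^ 3 * WOnorm WO *
          Real.sqrt (∑ _h : Fin H, R ^ 2) * R) ^ 2 with hF
  set G : ℝ := (⨆ i, F i) + (⨆ i, F i) + n ^ 2 * H * (⨆ i, frob (X i) ^ 2) * WOnorm WO ^ 2 with hG
  have hF0 : 0 ≤ ⨆ i, F i := Real.iSup_nonneg fun i => sq_nonneg _
  have hX0 : 0 ≤ ⨆ i, frob (X i) ^ 2 := Real.iSup_nonneg fun i => sq_nonneg _
  have hG0 : 0 ≤ G := by positivity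
  have hZ2 : (Z * ‖v - v'‖) ^ 2 = N ^ 2 * (G * ‖v - v'‖ ^ 2) := by
    rw [hZ, mul_pow, mul_pow, Real.sq_sqrt hG0]; ring
  rw [hZ2]
  -- pointwise bound
  have pt : ∀ ik : Fin N × Fin n,
      n ^ 2 * (MH (fun h => Ssoft (mQ v h) (mK v h) (X ik.1)) (mV v) WO (X ik.1) ik.2 -
            MH (fun h => Ssoft (mQ v' h) (mK v' h) (X ik.1)) (mV v') WO (X ik.1) ik.2) ^ 2 ≤
        G * ‖v - v'‖ ^ 2 := by
    rintro ⟨i, k⟩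
    have sb := sample_bound (X i) WO R (mQ v) (mK v) (mV v) (mQ v') (mK v') (mV v') hK hQ' hV k
    set q := enorm (fun h => frob (mQ v h - mQ v' h))
    set kk := enorm (fun h => frob (mK v h - mK v' h))
    set vv := enorm (fun h => frob (mV v h - mV v' h))
    set a := frob (X i) ^ 3 * R * (R * WOnorm WO) with ha
    set b := frob (X i) * WOnorm WO with hb
    have sq1 := pow_le_pow_left₀ (abs_nonneg _) sb 2
    rw [sq_abs] at sq1
    have sq2 := sq1.trans (c := (a ^ 2 + a ^ 2 + b ^ 2) * ‖v - v'‖ ^ 2) (by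
      rw [norm_split]
      refine le_trans (le_of_eq ?_) (cs3 a b q kk vv)
      rw [ha, hb]; ring)
    have f1 : n ^ 2 * a ^ 2 ≤ ⨆ i, F i := by
      have : F i = H ^ 2 * (n ^ 2 * a ^ 2) := by
        simp only [hF, ha, Finset.sum_const, Finset.card_univ, Fintype.card_fin, nsmul_eq_mul,
          mul_pow]
        rw [Real.sq_sqrt (by positivity), Real.sq_sqrt (by positivity)]
        ring
      refine le_trans ?_ (le_ciSup (Set.finite_range F).bddAbove i)
      rw [this]
      exact le_mul_of_one_le_left (by positivity) (one_le_pow₀ hH1)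
    have f2 : n ^ 2 * b ^ 2 ≤ n ^ 2 * H * (⨆ i, frob (X i) ^ 2) * WOnorm WO ^ 2 := by
      have s := le_ciSup (Set.finite_range fun i => frob (X i) ^ 2).bddAbove i
      rw [hb, mul_pow]
      calc _ = (n : ℝ) ^ 2 * 1 * frob (X i) ^ 2 * WOnorm WO ^ 2 := by ring
        _ ≤ _ := by gcongr
    calc _ ≤ (n : ℝ) ^ 2 * ((a ^ 2 + a ^ 2 + b ^ 2) * ‖v - v'‖ ^ 2) :=
          mul_le_mul_of_nonneg_left sq2 (by positivity)
      _ = (n ^ 2 * a ^ 2 + n ^ 2 * a ^ 2 + n ^ 2 * b ^ 2) * ‖v - v'‖ ^ 2 := by ring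
      _ ≤ _ := by rw [hG]; gcongr
  rcases Nat.eq_zero_or_pos N with hN | hN
  · subst hN; simp
  rcases Nat.eq_zero_or_pos n with hn | hn
  · subst hn
    rw [Fintype.sum_prod_type]
    simp only [Finset.univ_eq_empty, Finset.sum_empty, Finset.sum_const_zero]
    positivity
  have hN1 : (1 : ℝ) ≤ N := by exact_mod_cast hN
  have hn1 : (1 : ℝ) ≤ n := by exact_mod_cast hn
  have tot := Finset.sum_le_sum fun ik (_ : ik ∈ Finset.univ) => pt ik
  rw [← Finset.mul_sum] at tot
  simp only [Finset.sum_const, Finset.card_univ, Fintype.card_prod, Fintype.card_fin,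
    nsmul_eq_mul, Nat.cast_mul] at tot
  have hn2 : (0 : ℝ) < n ^ 2 := by positivity
  refine le_of_mul_le_mul_left (tot.trans ?_) hn2
  have hY : 0 ≤ G * ‖v - v'‖ ^ 2 := by positivity
  rw [← mul_assoc ((n : ℝ) ^ 2)]
  refine mul_le_mul_of_nonneg_right ?_ hY
  calc (N : ℝ) * n ≤ N ^ 2 * n ^ 2 :=
        mul_le_mul (le_self_pow₀ hN1 two_ne_zero) (le_self_pow₀ hn1 two_ne_zero)
          (by positivity) (by positivity)
    _ = _ := by ring

end Paper
end
end

section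
/- For the Softmax-attention Transformer, on any region of parameter space where σ_max(W^Q_h), σ_max(W^K_h) (for all h) and σ_max(W^V) are bounded by a fixed constant R, the gradient of the loss is Lipschitz: there exists a constant G > 0 (depending only on the data X, y, W^O, N, n, H, d and R) such that for any two parameter sets M, M′ in this region, ‖∇_M f(M; X) − ∇_M f(M′; X)‖₂ ≤ G ‖M − M′‖_F. -/
open scoped BigOperators
open scoped Matrix

noncomputable section

namespace Paper

variable {N n D d H : ℕ}

theorem entry_le_sigmaMax {m k : Type*} [Fintype m] [Fintype k] (A : Matrix m k ℝ)
    (i : m) (j : k) : |A i j| ≤ sigmaMax A := by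
  classical
  have hbdd : BddAbove {c | ∃ v : k → ℝ, (∑ j, v j ^ 2) = 1 ∧ c = enorm (A.mulVec v)} := by
    refine ⟨frob A, ?_⟩
    rintro c ⟨v, hv, rfl⟩
    unfold enorm frob
    apply Real.sqrt_le_sqrt
    apply Finset.sum_le_sum
    intro i _
    have := Finset.sum_mul_sq_le_sq_mul_sq Finset.univ (fun j => A i j) v
    rw [hv, mul_one] at this
    exact this
  have h1 : enorm (A.mulVec (Pi.single j 1)) ≤ sigmaMax A := by
    apply le_csSup hbdd
    refine ⟨Pi.single j 1, ?_, rfl⟩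
    rw [Finset.sum_eq_single j]
    · simp
    · intro b _ hb
      simp [Pi.single_eq_of_ne hb]
    · simp
  refine le_trans ?_ h1
  unfold enorm
  apply Real.le_sqrt_of_sq_le
  rw [sq_abs]
  have := Finset.single_le_sum (f := fun i => (A.mulVec (Pi.single j 1)) i ^ 2)
    (fun i _ => sq_nonneg _) (Finset.mem_univ i)
  simpa using this

theorem norm_le_of_region {H D d : ℕ} (R : ℝ) (v : EuclideanSpace ℝ (FullIdx H D d))
    (hQ : ∀ h, sigmaMax (mQ v h) ≤ R) (hK : ∀ h, sigmaMax (mK v h) ≤ R)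
    (hV : sigmaMax (diagWV (mV v)) ≤ R) :
    ‖v‖ ≤ Real.sqrt (∑ _i : FullIdx H D d, R ^ 2) := by
  rw [EuclideanSpace.norm_eq]
  apply Real.sqrt_le_sqrt
  apply Finset.sum_le_sum
  rintro ⟨t, h, p, q⟩ _
  have key : |v (t, h, p, q)| ≤ R := by
    fin_cases t
    · exact (entry_le_sigmaMax (mQ v h) p q).trans (hQ h)
    · exact (entry_le_sigmaMax (mK v h) p q).trans (hK h)
    · have := (entry_le_sigmaMax (diagWV (mV v)) (h, p) (h, q)).trans hV
      simpa [diagWV, mV] using this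
  rw [Real.norm_eq_abs]
  exact pow_le_pow_left₀ (abs_nonneg _) key 2

theorem loss_contDiff {N n D d H : ℕ}
    (X : Fin N → Matrix (Fin n) (Fin D) ℝ) (y : Fin N → Fin n → ℝ)
    (WO : Fin H → Fin d → ℝ) :
    ContDiff ℝ 2 (fun v : EuclideanSpace ℝ (FullIdx H D d) =>
      lossOf (fun i => MH (fun h => Ssoft (mQ v h) (mK v h) (X i)) (mV v) WO (X i)) y) := by
  have hc : ∀ j : FullIdx H D d,
      ContDiff ℝ 2 (fun v : EuclideanSpace ℝ (FullIdx H D d) => v j) := by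
    intro j
    fun_prop
  have hC : ∀ (i : Fin N) (h : Fin H) (k l : Fin n),
      ContDiff ℝ 2 (fun v : EuclideanSpace ℝ (FullIdx H D d) =>
        attnC (mQ v h) (mK v h) (X i) k l) := by
    intro i h k l
    simp only [attnC, mQ, mK, Matrix.smul_apply, Matrix.mul_apply, Matrix.transpose_apply,
      Matrix.of_apply, smul_eq_mul]
    fun_prop
  have hS : ∀ (i : Fin N) (h : Fin H) (k l : Fin n),
      ContDiff ℝ 2 (fun v : EuclideanSpace ℝ (FullIdx H D d) =>
        Ssoft (mQ v h) (mK v h) (X i) k l) := by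
    intro i h k l
    simp only [Ssoft, softmaxMat, Matrix.of_apply]
    refine ContDiff.div (hC i h k l).exp (ContDiff.sum fun m _ => (hC i h k m).exp) ?_
    intro v
    exact (Finset.sum_pos (fun m _ => Real.exp_pos _) ⟨k, Finset.mem_univ k⟩).ne'
  simp only [lossOf, MH, Matrix.mul_apply, mV, Matrix.of_apply]
  refine contDiff_const.mul (ContDiff.sum fun i _ => ContDiff.sum fun k _ =>
    ContDiff.pow (ContDiff.sub (ContDiff.sum fun h _ => ContDiff.sum fun l _ =>
      ContDiff.mul (ContDiff.sum fun p _ => ContDiff.mul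
        (ContDiff.sum fun m _ => (hS i h k m).mul contDiff_const) (hc _)) contDiff_const)
      contDiff_const) 2)

/-- Lemma 3(2) of the paper. On a region where all singular values of
`W^Q_h`, `W^K_h` and `W^V` are bounded by `R`, the gradient of the Softmax-attention
Transformer loss is Lipschitz: `‖∇f(M;X) − ∇f(M′;X)‖₂ ≤ G ‖M − M′‖_F` for some `G > 0`. -/
theorem softmax_gradient_lipschitz
    {N n D d H : ℕ}
    (X : Fin N → Matrix (Fin n) (Fin D) ℝ) (y : Fin N → Fin n → ℝ)
    (WO : Fin H → Fin d → ℝ)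
    (f : EuclideanSpace ℝ (FullIdx H D d) → ℝ)
    (hf : f = fun v =>
      lossOf (fun i => MH (fun h => Ssoft (mQ v h) (mK v h) (X i)) (mV v) WO (X i)) y)
    (R : ℝ) :
    ∃ G : ℝ, 0 < G ∧
      ∀ v v' : EuclideanSpace ℝ (FullIdx H D d),
        (∀ h, sigmaMax (mQ v h) ≤ R) → (∀ h, sigmaMax (mK v h) ≤ R) →
        sigmaMax (diagWV (mV v)) ≤ R →
        (∀ h, sigmaMax (mQ v' h) ≤ R) → (∀ h, sigmaMax (mK v' h) ≤ R) →
        sigmaMax (diagWV (mV v')) ≤ R →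
        ‖gradient f v - gradient f v'‖ ≤ G * ‖v - v'‖ := by
  have hcd : ContDiff ℝ 2 f := by
    rw [hf]
    exact loss_contDiff X y WO
  have hd : ContDiff ℝ 1 (fderiv ℝ f) := hcd.fderiv_right (by norm_num)
  obtain ⟨K, hK⟩ := (hd.contDiffOn (s := Metric.closedBall 0
    (Real.sqrt (∑ _i : FullIdx H D d, R ^ 2)))).exists_lipschitzOnWith one_ne_zero
    (convex_closedBall _ _) (isCompact_closedBall _ _)
  refine ⟨K + 1, by positivity, ?_⟩
  intro v v' h1 h2 h3 h4 h5 h6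
  have hv := norm_le_of_region R v h1 h2 h3
  have hv' := norm_le_of_region R v' h4 h5 h6
  have := hK.norm_sub_le (mem_closedBall_zero_iff.2 hv) (mem_closedBall_zero_iff.2 hv')
  rw [gradient, gradient, ← map_sub, LinearIsometryEquiv.norm_map]
  refine this.trans ?_
  have := norm_nonneg (v - v')
  nlinarith

end Paper
end
end

section
/- For the Gaussian-kernel Transformer, the derivative of the per-sample loss with respect to the pre-activation matrix C_i has the closed form ∂f(M; X_i)/∂C_i = ((MH(M; X_i) − y_i)(W^O)^T (V′_i)^T) ⊙ S_i, and it satisfies the lower bound ‖∂f(M; X_i)/∂C_i‖_F ≥ min|V′_i W^O| · min(S_i) · ‖MH(M; X_i) − y_i‖₂, where min|V′_i W^O| is the smallest absolute value of the entries of the vector V′_i W^O and min(S_i) is the smallest entry of the (entrywise positive) matrix S_i. -/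
open scoped BigOperators
open scoped Matrix

noncomputable section

namespace Paper

variable {N n D d H : ℕ}

/-- `V′_i = diag(X_i W^V_1, …, X_i W^V_H) ∈ ℝ^{Hn × Hd}` for a single sample. -/
def VblkI {n D d H : ℕ} (Xi : Matrix (Fin n) (Fin D) ℝ)
    (WV : Fin H → Matrix (Fin D) (Fin d) ℝ) :
    Matrix (Fin H × Fin n) (Fin H × Fin d) ℝ :=
  Matrix.of fun hk hq => if hk.1 = hq.1 then (Xi * WV hk.1) hk.2 hq.2 else 0

/-- The model output as a function of the (packed) Gaussian pre-kernel matrix `C_i`: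
the kernel is `S_i = exp(C_i)` entrywise. -/
def mhOfC {n D d H : ℕ} (Xi : Matrix (Fin n) (Fin D) ℝ)
    (WV : Fin H → Matrix (Fin D) (Fin d) ℝ) (WO : Fin H → Fin d → ℝ)
    (c : EuclideanSpace ℝ (Fin n × Fin H × Fin n)) : Fin n → ℝ :=
  MH (fun h => Matrix.of fun k j => Real.exp (c (k, h, j))) WV WO Xi

/-- The per-sample loss as a function of the (packed) pre-kernel matrix `C_i`. -/
def lossOfC {n D d H : ℕ} (Xi : Matrix (Fin n) (Fin D) ℝ) (yi : Fin n → ℝ)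
    (WV : Fin H → Matrix (Fin D) (Fin d) ℝ) (WO : Fin H → Fin d → ℝ)
    (c : EuclideanSpace ℝ (Fin n × Fin H × Fin n)) : ℝ :=
  (1 / 2) * ∑ k, (mhOfC Xi WV WO c k - yi k) ^ 2

lemma aux_mh {n D d H : ℕ} (Xi : Matrix (Fin n) (Fin D) ℝ)
    (WV : Fin H → Matrix (Fin D) (Fin d) ℝ) (WO : Fin H → Fin d → ℝ)
    (c : EuclideanSpace ℝ (Fin n × Fin H × Fin n)) (k : Fin n) :
    mhOfC Xi WV WO c k = ∑ hj : Fin H × Fin n,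
      Real.exp (c (k, hj)) * ∑ hq, VblkI Xi WV hj hq * WO hq.1 hq.2 := by
  unfold mhOfC MH VblkI
  rw [Fintype.sum_prod_type]
  refine Finset.sum_congr rfl fun h _ => ?_
  have e : ∀ j : Fin n, (∑ hq : Fin H × Fin d,
      (Matrix.of fun (hk : Fin H × Fin n) (hq : Fin H × Fin d) =>
        if hk.1 = hq.1 then (Xi * WV hk.1) hk.2 hq.2 else 0) (h, j) hq * WO hq.1 hq.2)
      = ∑ l, (Xi * WV h) j l * WO h l := by
    intro j
    rw [Fintype.sum_prod_type]
    rw [Finset.sum_eq_single h]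
    · simp
    · intro b _ hb
      simp [Ne.symm hb]
    · simp
  simp_rw [e, Matrix.mul_assoc]
  simp_rw [Finset.mul_sum]
  rw [Finset.sum_comm]
  refine Finset.sum_congr rfl fun l _ => ?_
  rw [Matrix.mul_apply, Finset.sum_mul]
  refine Finset.sum_congr rfl fun j _ => ?_
  simp [mul_assoc]

lemma aux_grad {n D d H : ℕ} (Xi : Matrix (Fin n) (Fin D) ℝ) (yi : Fin n → ℝ)
    (WV : Fin H → Matrix (Fin D) (Fin d) ℝ) (WO : Fin H → Fin d → ℝ)
    (c : EuclideanSpace ℝ (Fin n × Fin H × Fin n)) :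
    HasGradientAt (lossOfC Xi yi WV WO)
      (WithLp.toLp 2 fun p : Fin n × Fin H × Fin n =>
        ((mhOfC Xi WV WO c p.1 - yi p.1) * ∑ hq, VblkI Xi WV p.2 hq * WO hq.1 hq.2) *
            Real.exp (c p)) c := by
  rw [hasGradientAt_iff_hasFDerivAt]
  have hp : ∀ p : Fin n × Fin H × Fin n,
      HasFDerivAt (fun x : EuclideanSpace ℝ (Fin n × Fin H × Fin n) => x p)
        (EuclideanSpace.proj p : EuclideanSpace ℝ (Fin n × Fin H × Fin n) →L[ℝ] ℝ) c :=
    fun p => (EuclideanSpace.proj p :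
      EuclideanSpace ℝ (Fin n × Fin H × Fin n) →L[ℝ] ℝ).hasFDerivAt
  have hm : ∀ k : Fin n, HasFDerivAt (fun x => mhOfC Xi WV WO x k)
      (∑ hj : Fin H × Fin n, (∑ hq, VblkI Xi WV hj hq * WO hq.1 hq.2) •
        (Real.exp (c (k, hj)) • (EuclideanSpace.proj (k, hj) :
          EuclideanSpace ℝ (Fin n × Fin H × Fin n) →L[ℝ] ℝ))) c := by
    intro k
    simp_rw [aux_mh]
    exact HasFDerivAt.fun_sum fun hj _ => ((hp (k, hj)).exp.mul_const _)
  have hl : HasFDerivAt (𝕜 := ℝ) (lossOfC Xi yi WV WO) _ c :=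
    (HasFDerivAt.fun_sum (u := Finset.univ) fun k _ =>
      ((hm k).sub_const (yi k)).pow 2).const_mul (1 / 2 : ℝ)
  refine hl.congr_fderiv ?_
  ext v
  simp only [InnerProductSpace.toDual_apply_apply, PiLp.inner_apply]
  rw [Fintype.sum_prod_type]
  simp only [ContinuousLinearMap.smul_apply, ContinuousLinearMap.sum_apply, smul_eq_mul,
    Finset.mul_sum]
  refine Finset.sum_congr rfl fun k _ => Finset.sum_congr rfl fun hj _ => ?_
  simp [← Finset.mul_sum]
  ring

/-- Lemma 8(4) and Lemma 9(3) of the paper. For the Gaussian-kernel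
Transformer, `∂f(M;X_i)/∂C_i = ((MH(M;X_i) − y_i)(W^O)ᵀ(V′_i)ᵀ) ⊙ S_i`, and
`‖∂f(M;X_i)/∂C_i‖_F ≥ min|V′_i W^O| ⋅ min(S_i) ⋅ ‖MH(M;X_i) − y_i‖₂`. -/
theorem gaussian_dfdC_closed_form_and_lower_bound
    {n D d H : ℕ}
    (Xi : Matrix (Fin n) (Fin D) ℝ) (yi : Fin n → ℝ)
    (WV : Fin H → Matrix (Fin D) (Fin d) ℝ) (WO : Fin H → Fin d → ℝ) :
    ∀ c : EuclideanSpace ℝ (Fin n × Fin H × Fin n),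
      (∀ (k : Fin n) (h : Fin H) (j : Fin n),
        gradient (lossOfC Xi yi WV WO) c (k, h, j) =
          ((mhOfC Xi WV WO c k - yi k) * ∑ hq, WO hq.1 hq.2 * VblkI Xi WV (h, j) hq) *
            Real.exp (c (k, h, j))) ∧
      (⨅ hk : Fin H × Fin n, |∑ hq, VblkI Xi WV hk hq * WO hq.1 hq.2|) *
          (⨅ khj : Fin n × Fin H × Fin n, Real.exp (c khj)) *
          enorm (fun k => mhOfC Xi WV WO c k - yi k) ≤
        ‖gradient (lossOfC Xi yi WV WO) c‖ := by
  intro c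
  have hg := (aux_grad Xi yi WV WO c).gradient
  refine ⟨?_, ?_⟩
  · intro k h j
    rw [hg]
    simp only [mul_comm (WO _ _)]
  · rw [hg, EuclideanSpace.norm_eq]
    set A := ⨅ hk : Fin H × Fin n, |∑ hq, VblkI Xi WV hk hq * WO hq.1 hq.2| with hA
    set B := ⨅ khj : Fin n × Fin H × Fin n, Real.exp (c khj) with hB
    have hA0 : 0 ≤ A := Real.iInf_nonneg fun _ => abs_nonneg _
    have hB0 : 0 ≤ B := Real.iInf_nonneg fun _ => (Real.exp_pos _).le
    have hAle : ∀ hk, A ≤ |∑ hq, VblkI Xi WV hk hq * WO hq.1 hq.2| := fun hk =>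
      ciInf_le (Set.finite_range _).bddBelow hk
    have hBle : ∀ p, B ≤ Real.exp (c p) := fun p =>
      ciInf_le (Set.finite_range _).bddBelow p
    apply Real.le_sqrt_of_sq_le
    unfold enorm
    rw [mul_pow, Real.sq_sqrt (Finset.sum_nonneg fun _ _ => sq_nonneg _),
      Fintype.sum_prod_type, Finset.mul_sum]
    refine Finset.sum_le_sum fun k _ => ?_
    rcases isEmpty_or_nonempty (Fin H × Fin n) with he | ⟨⟨hj⟩⟩
    · have : A = 0 := by rw [hA, Real.iInf_of_isEmpty]
      simp [this]
    · refine le_trans ?_ (Finset.single_le_sum (f := fun hj => ‖_‖ ^ 2)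
        (fun _ _ => sq_nonneg _) (Finset.mem_univ hj))
      simp only [Real.norm_eq_abs, abs_mul, mul_pow, Real.abs_exp]
      rw [← sq_abs (mhOfC Xi WV WO c k - yi k)]
      have h1 := pow_le_pow_left₀ hA0 (hAle hj) 2
      have h2 := pow_le_pow_left₀ hB0 (hBle (k, hj)) 2
      have h3 := mul_le_mul h1 h2 (by positivity) (by positivity)
      have h4 := mul_le_mul_of_nonneg_left h3 (sq_nonneg |mhOfC Xi WV WO c k - yi k|)
      nlinarith [h4]

end Paper
end
end
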